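/- arXiv:1312.3075 — 2 statements merged into one kernel-verified Lean document; each statement's English description precedes it below -/
import Mathlib

section
/- Let P = (J_1, ..., J_t) be a chain of distinct open intervals of ℝ (consecutive intervals intersect) and define Supp P = J_1 ∪ (J_2 ∩ J_3) ∪ (J_4 ∩ J_5) ∪ ... ∪ (J_{t−2} ∩ J_{t−1}) ∪ J_t (more precisely, J_1 ∪ J_t ∪ the union over 2 ≤ i ≤ t−2 of J_i ∩ J_{i+1}). If A is an open interval not among J_1, ..., J_t and A ∩ Supp P ≠ ∅, then there is a chain of length t+1 whose set of intervals is {A, J_1, ..., J_t}. -/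
/-- A chain of intervals: a list of distinct sets in which consecutive members intersect. -/
def IChain (P : List (Set ℝ)) : Prop :=
  P.Nodup ∧ List.Chain' (fun A B => (A ∩ B).Nonempty) P

/-- The support of a chain `P = (J_1, …, J_t)`:
`J_1 ∪ J_t ∪ ⋃_{2 ≤ i ≤ t-2} (J_i ∩ J_{i+1})` (1-indexed). -/
def supp (P : List (Set ℝ)) : Set ℝ :=
  P.getD 0 ∅ ∪ P.getD (P.length - 1) ∅ ∪
    ⋃ i ∈ Finset.Ico 1 (P.length - 2), (P.getD i ∅ ∩ P.getD (i + 1) ∅)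

/-- An element related to its two new neighbours can be inserted into a chain. -/
theorem List.IsChain.append_cons {α : Type*} {R : α → α → Prop} {l₁ l₂ : List α} {a : α}
    (h : (l₁ ++ l₂).IsChain R) (h₁ : ∀ x ∈ l₁.getLast?, R x a) (h₂ : ∀ y ∈ l₂.head?, R a y) :
    (l₁ ++ a :: l₂).IsChain R := by
  rw [List.isChain_append] at h ⊢
  refine ⟨h.1, List.isChain_cons.2 ⟨h₂, h.2.1⟩, fun x hx y hy => ?_⟩
  obtain rfl : a = y := by simpa using hy
  exact h₁ x hx

/-- A set outside a chain that meets both of its new neighbours can be inserted into it. -/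
theorem IChain.exists_insert {P l₁ l₂ : List (Set ℝ)} {A : Set ℝ} (hP : IChain P) (hAP : A ∉ P)
    (hl : l₁ ++ l₂ = P) (h₁ : ∀ B ∈ l₁.getLast?, (B ∩ A).Nonempty)
    (h₂ : ∀ B ∈ l₂.head?, (A ∩ B).Nonempty) :
    ∃ Q : List (Set ℝ), IChain Q ∧ Q.Perm (A :: P) ∧ Q.length = P.length + 1 := by
  subst hl
  have hperm : (l₁ ++ A :: l₂).Perm (A :: (l₁ ++ l₂)) := List.perm_middle
  exact ⟨_, ⟨hperm.nodup_iff.2 (List.nodup_cons.2 ⟨hAP, hP.1⟩),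
    List.IsChain.append_cons hP.2 h₁ h₂⟩, hperm, hperm.length_eq⟩

/-- If `A` is an open interval not among the members of the chain `P` and `A` meets the
support of `P`, then there is a chain of length `|P| + 1` whose set of intervals is
`{A} ∪ P`. -/
theorem stmt4 (P : List (Set ℝ)) (hne : P ≠ [])
    (hopen : ∀ J ∈ P, ∃ a b : ℝ, J = Set.Ioo a b) (hP : IChain P)
    (A : Set ℝ) (hA : ∃ a b : ℝ, A = Set.Ioo a b) (hAP : A ∉ P)
    (hmeet : (A ∩ supp P).Nonempty) :
    ∃ Q : List (Set ℝ), IChain Q ∧ Q.Perm (A :: P) ∧ Q.length = P.length + 1 := by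
  obtain ⟨x, hxA, hx⟩ := hmeet
  have key : ∀ (o : Option (Set ℝ)), x ∈ o.getD ∅ → ∀ B ∈ o, x ∈ B := by
    rintro o ho B rfl
    exact ho
  simp only [supp, Set.mem_union, Set.mem_iUnion, Finset.mem_Ico, List.getD_eq_getElem?_getD]
    at hx
  rcases hx with (hx | hx) | ⟨i, hi, hx, hx'⟩
  · refine hP.exists_insert hAP (List.nil_append P) (by simp) fun B hB => ⟨x, hxA, ?_⟩
    exact key _ hx B (by rwa [← List.head?_eq_getElem?])
  · refine hP.exists_insert hAP (List.append_nil P) (fun B hB => ⟨x, ?_, hxA⟩) (by simp)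
    exact key _ hx B (by rwa [← List.getLast?_eq_getElem?])
  · refine hP.exists_insert hAP (List.take_append_drop (i + 1) P)
      (fun B hB => ⟨x, ?_, hxA⟩) fun B hB => ⟨x, hxA, ?_⟩
    · have hlt : i < P.length := by omega
      refine key _ hx B ?_
      simpa [List.getLast?_take, List.getElem?_eq_getElem hlt] using hB
    · exact key _ hx' B (by rwa [List.head?_drop] at hB)
end

section
/- If G is a connected circular arc graph, then the intersection of all longest paths of G is nonempty; that is, there exists a vertex contained in every longest path of G. -/
noncomputable section

/-- The circle, modeled as `ℝ / ℤ`. -/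
abbrev Circ : Type := AddCircle (1 : ℝ)

/-- The open arc starting at `a` and running clockwise for length `d`. -/
def arc (a : Circ) (d : ℝ) : Set Circ :=
  (fun t : ℝ => a + (↑t : Circ)) '' Set.Ioo 0 d

/-- An open (proper) arc of the circle. -/
def IsArc (A : Set Circ) : Prop :=
  ∃ (a : Circ) (d : ℝ), 0 < d ∧ d < 1 ∧ A = arc a d

/-- A chain in `F`: a list of distinct members of `F` with consecutive members
intersecting. -/
def ArcChain (F : Set (Set Circ)) (P : List (Set Circ)) : Prop :=
  P.Nodup ∧ (∀ A ∈ P, A ∈ F) ∧ List.Chain' (fun A B => (A ∩ B).Nonempty) P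

/-- A longest chain in `F`. -/
def IsLongestArcChain (F : Set (Set Circ)) (P : List (Set Circ)) : Prop :=
  ArcChain F P ∧ ∀ Q, ArcChain F Q → Q.length ≤ P.length

/-- The points `p 0, …, p (n-1)` occur consecutively in clockwise order on the circle. -/
def CyclicallyOrdered {n : ℕ} (p : Fin n → Circ) : Prop :=
  ∃ (a : Circ) (t : Fin n → ℝ), StrictMono t ∧ (∀ i, t i ∈ Set.Ico (0 : ℝ) 1) ∧
    ∀ i, p i = a + (↑(t i) : Circ)

/-- The open clockwise arc strictly between the points `p` and `q`. -/
def arcBetween (p q : Circ) : Set Circ :=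
  {x | ∃ s u : ℝ, 0 < s ∧ s < u ∧ u < 1 ∧ x = p + (↑s : Circ) ∧ q = p + (↑u : Circ)}

/-- `A` precedes `B` in the list `L`. -/
def Precedes (L : List (Set Circ)) (A B : Set Circ) : Prop :=
  ∃ i j : ℕ, i < j ∧ j < L.length ∧ L.getD i ∅ = A ∧ L.getD j ∅ = B

/-- `ΔK_i = {x : ℓ(K_{i+1}) < x < r(K_i)}`, for arcs `K i = arc (c i) (d i)`. -/
def deltaK {n : ℕ} [NeZero n] (c : Fin n → Circ) (d : Fin n → ℝ) (i : Fin n) :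
    Set Circ :=
  arcBetween (c (i + 1)) (c i + (↑(d i) : Circ))


/-- A list of distinct vertices whose consecutive members are adjacent. -/
def PathList {V : Type*} (G : SimpleGraph V) (L : List V) : Prop :=
  L.Nodup ∧ L.IsChain G.Adj

/-- A path list of maximum length. -/
def LongestPathList {V : Type*} (G : SimpleGraph V) (L : List V) : Prop :=
  PathList G L ∧ ∀ M, PathList G M → M.length ≤ L.length

theorem List.exists_last_split {α : Type*} (p : α → Prop) :
    ∀ L : List α, (∃ x ∈ L, p x) → ∃ A q B, L = A ++ q :: B ∧ p q ∧ ∀ y ∈ B, ¬ p y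
  | [], h => by simp at h
  | x :: L, h => by
    by_cases hL : ∃ y ∈ L, p y
    · obtain ⟨A, q, B, rfl, hq, hB⟩ := List.exists_last_split p L hL
      exact ⟨x :: A, q, B, rfl, hq, hB⟩
    · push Not at hL
      obtain ⟨y, hy, hpy⟩ := h
      rcases List.mem_cons.1 hy with rfl | hy
      · exact ⟨[], y, L, rfl, hpy, hL⟩
      · exact absurd hpy (hL y hy)

section IntervalChains

variable {α : Type*} (f g : α → ℝ)

/-- The open intervals `(f x, g x)` and `(f y, g y)` overlap. -/
def IntervalMeets (x y : α) : Prop := f x < g y ∧ f y < g x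

/-- Both endpoints of the interval of `x` are smaller than those of the interval of `y`. -/
def IntervalBelow (x y : α) : Prop := f x < f y ∧ g x < g y

variable {f g}

theorem IntervalMeets.symm {x y : α} (h : IntervalMeets f g x y) : IntervalMeets f g y x :=
  ⟨h.2, h.1⟩

theorem IntervalBelow.trans {x y z : α} (h : IntervalBelow f g x y) (h' : IntervalBelow f g y z) :
    IntervalBelow f g x z :=
  ⟨h.1.trans h'.1, h.2.trans h'.2⟩

theorem IntervalBelow.irrefl (x : α) : ¬ IntervalBelow f g x x := fun h => lt_irrefl _ h.1

/-- An interval that meets an interval below `p` but is not itself below `p` meets `p`. -/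
theorem IntervalMeets.of_below {p q b : α} (hfg : ∀ x, f x < g x)
    (hqb : IntervalMeets f g q b) (hqp : IntervalBelow f g q p) (hbp : ¬ IntervalBelow f g b p) :
    IntervalMeets f g p b := by
  refine ⟨?_, hqb.2.trans hqp.2⟩
  by_contra h
  have := hfg b
  have := hfg p
  exact hbp ⟨by linarith, by linarith⟩

open Classical in
/-- A chain of intervals can be rearranged so that no later interval is below the first. -/
theorem exists_perm_head_minimal (hfg : ∀ x, f x < g x) (E : α → Prop) (n : ℕ) :
    ∀ (p : α) (T : List α), (p :: T).countP (fun y => decide (IntervalBelow f g y p)) ≤ n →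
      (p :: T).IsChain (IntervalMeets f g) → E p →
      (∀ x ∈ p :: T, ∀ y ∈ p :: T, E x → IntervalBelow f g y x → E y) →
      ∃ p' T', (p' :: T').Perm (p :: T) ∧ (p' :: T').IsChain (IntervalMeets f g) ∧ E p' ∧
        ∀ y ∈ T', ¬ IntervalBelow f g y p' := by
  induction n with
  | zero =>
    intro p T hn hc hE _
    refine ⟨p, T, List.Perm.refl _, hc, hE, fun y hy hlt => ?_⟩
    have h0 := List.countP_eq_zero.1 (Nat.le_zero.1 hn) y (List.mem_cons_of_mem _ hy)
    simp [hlt] at h0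
  | succ n ih =>
    intro p T hn hc hE hdown
    by_cases hT : ∃ y ∈ T, IntervalBelow f g y p
    · obtain ⟨A, q, B, rfl, hq, hB⟩ := List.exists_last_split _ _ hT
      have hsplit : p :: (A ++ q :: B) = (p :: A ++ [q]) ++ B := by simp
      have hperm : (q :: (A.reverse ++ p :: B)).Perm (p :: (A ++ q :: B)) := by
        have e : q :: (A.reverse ++ p :: B) = (p :: A ++ [q]).reverse ++ B := by simp
        rw [e, hsplit]
        exact (List.reverse_perm _).append_right B
      have hchain : (q :: (A.reverse ++ p :: B)).IsChain (IntervalMeets f g) := by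
        have e : q :: (A.reverse ++ p :: B) = (p :: A ++ [q]).reverse ++ B := by simp
        rw [hsplit, List.isChain_append] at hc
        obtain ⟨h1, h2, h3⟩ := hc
        rw [e, List.isChain_append]
        refine ⟨?_, h2, ?_⟩
        · rw [List.isChain_reverse]
          exact h1.imp fun _ _ h => h.symm
        · intro x hx b hb
          have hx' : x = p := by
            rw [List.getLast?_reverse] at hx
            simpa using hx.symm
          subst hx'
          have hqb := h3 q (by rw [List.getLast?_append]; simp) b hb
          exact hqb.of_below hfg hq (hB b (List.mem_of_mem_head? hb))
      have hEq : E q := hdown p (by simp) q (by simp) hE hq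
      have hcount : (q :: (A.reverse ++ p :: B)).countP (fun y => decide (IntervalBelow f g y q))
          ≤ n := by
        refine Nat.le_of_lt_succ (lt_of_lt_of_le ?_ hn)
        rw [hperm.countP_eq]
        have key : ∀ M : List α, q ∈ M →
            M.countP (fun y => decide (IntervalBelow f g y q)) <
            M.countP (fun y => decide (IntervalBelow f g y p)) := by
          intro M hM
          induction M with
          | nil => simp at hM
          | cons m M ihM =>
            have hle : M.countP
                  (fun y => decide (IntervalBelow f g y q)) ≤
                M.countP (fun y => decide (IntervalBelow f g y p)) := by
              apply List.countP_mono_left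
              intro x _ hx
              have hx' : IntervalBelow f g x q := by simpa using hx
              simpa using hx'.trans hq
            rw [List.countP_cons, List.countP_cons]
            rcases List.mem_cons.1 hM with rfl | hM
            · have := IntervalBelow.irrefl (f := f) (g := g) q
              simp [hq, this]
              omega
            · have := ihM hM
              by_cases hmq : IntervalBelow f g m q
              · have := hmq.trans hq
                simp [hmq, this]
                omega
              · simp [hmq]
                omega
        exact key _ (by simp)
      obtain ⟨p', T', h1, h2, h3, h4⟩ := ih q (A.reverse ++ p :: B) hcount hchain hEq
        fun x hx y hy => hdown x (hperm.mem_iff.1 hx) y (hperm.mem_iff.1 hy)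
      exact ⟨p', T', h1.trans hperm, h2, h3, h4⟩
    · push Not at hT
      exact ⟨p, T, List.Perm.refl _, hc, hE, hT⟩

theorem exists_perm_normal_aux (hfg : ∀ x, f x < g x) (n : ℕ) :
    ∀ (E : α → Prop) (L : List α), L.length ≤ n → L.IsChain (IntervalMeets f g) →
      (∀ p ∈ L.head?, E p) →
      (∀ x ∈ L, ∀ y ∈ L, E x → IntervalBelow f g y x → E y) →
      ∃ L' : List α, L'.Perm L ∧ L'.IsChain (IntervalMeets f g) ∧ (∀ p ∈ L'.head?, E p) ∧
        L'.Pairwise fun x y => ¬ IntervalBelow f g y x := by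
  induction n with
  | zero =>
    intro E L hL _ _ _
    have : L = [] := List.length_eq_zero_iff.1 (Nat.le_zero.1 hL)
    subst this
    exact ⟨[], List.Perm.refl _, List.isChain_nil, by simp, List.Pairwise.nil⟩
  | succ n ih =>
    intro E L hL hc hE hdown
    cases L with
    | nil => exact ⟨[], List.Perm.refl _, List.isChain_nil, by simp, List.Pairwise.nil⟩
    | cons p T =>
      obtain ⟨p', T', hperm, hc', hE', hmin⟩ :=
        exists_perm_head_minimal hfg E _ p T le_rfl hc (hE p (by simp)) hdown
      rw [List.isChain_cons] at hc'
      have hlen := hperm.length_eq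
      obtain ⟨T'', h1, h2, h3, h4⟩ := ih (IntervalMeets f g p') T'
        (by simp at hlen hL; omega) hc'.2 hc'.1 (by
          intro x _ y hy hx hyx
          refine ⟨?_, hyx.1.trans hx.2⟩
          by_contra h
          have h5 := hfg y
          have h6 := hfg p'
          exact hmin y hy ⟨by linarith, by linarith⟩)
      refine ⟨p' :: T'', (h1.cons p').trans hperm, ?_, ?_, ?_⟩
      · rw [List.isChain_cons]
        exact ⟨h3, h2⟩
      · simpa using hE'
      · rw [List.pairwise_cons]
        exact ⟨fun y hy => hmin y (h1.mem_iff.1 hy), h4⟩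

/-- A chain of intervals can be rearranged into a chain whose order extends the componentwise
order on the pairs of endpoints. -/
theorem exists_perm_normal (hfg : ∀ x, f x < g x) (L : List α)
    (hL : L.IsChain (IntervalMeets f g)) :
    ∃ L' : List α, L'.Perm L ∧ L'.IsChain (IntervalMeets f g) ∧
      L'.Pairwise fun x y => ¬ IntervalBelow f g y x := by
  obtain ⟨L', h1, h2, -, h4⟩ := exists_perm_normal_aux hfg _ (fun _ => True) L le_rfl hL
    (fun _ _ => trivial) (fun _ _ _ _ _ _ => trivial)
  exact ⟨L', h1, h2, h4⟩

end IntervalChains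

section PathLists

variable {V : Type*} {G : SimpleGraph V} {L : List V}

theorem LongestPathList.not_adj_consecutive {A B : List V} {x y u : V}
    (h : LongestPathList G (A ++ x :: y :: B)) (hu : u ∉ A ++ x :: y :: B) :
    ¬ (G.Adj u x ∧ G.Adj u y) := by
  rintro ⟨hx, hy⟩
  have hlen := h.2 (A ++ x :: u :: y :: B) ⟨?_, ?_⟩
  · simp at hlen
  · have hp : (A ++ x :: u :: y :: B).Perm (u :: (A ++ x :: y :: B)) := by
      have e : A ++ x :: u :: y :: B = (A ++ [x]) ++ u :: (y :: B) := by simp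
      have e' : A ++ x :: y :: B = (A ++ [x]) ++ (y :: B) := by simp
      rw [e, e']
      exact List.perm_middle
    rw [hp.nodup_iff, List.nodup_cons]
    exact ⟨hu, h.1.1⟩
  · have hc := h.1.2
    rw [List.isChain_append_cons_cons] at hc ⊢
    rw [List.isChain_cons_cons]
    exact ⟨hc.1, hx.symm, hy, hc.2.2⟩

theorem LongestPathList.exists_adj (h : LongestPathList G L) (h2 : 2 ≤ L.length) {x : V}
    (hx : x ∈ L) : ∃ y ∈ L, G.Adj x y ∧ ∀ u ∉ L, ¬ (G.Adj u x ∧ G.Adj u y) := by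
  obtain ⟨A, B, rfl⟩ := List.append_of_mem hx
  cases B with
  | cons y B =>
    have hc := h.1.2
    rw [List.isChain_append_cons_cons] at hc
    exact ⟨y, by simp, hc.2.1, fun u hu => h.not_adj_consecutive hu⟩
  | nil =>
    rcases List.eq_nil_or_concat A with rfl | ⟨A, y, rfl⟩
    · simp at h2
    · have e : (A.concat y) ++ [x] = A ++ y :: x :: [] := by simp
      rw [e] at h ⊢
      have hc := h.1.2
      rw [List.isChain_append_cons_cons] at hc
      exact ⟨y, by simp, hc.2.1.symm, fun u hu hux => h.not_adj_consecutive hu hux.symm⟩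

theorem LongestPathList.of_perm {M : List V} (h : LongestPathList G L) (hp : M.Perm L)
    (hM : M.IsChain G.Adj) : LongestPathList G M :=
  ⟨⟨hp.nodup_iff.2 h.1.1, hM⟩, fun N hN => (h.2 N hN).trans hp.length_eq.ge⟩

end PathLists

/-- The arcs `(l v, r v)` modulo `1` represent the graph `G`. -/
structure IsArcModel {V : Type*} (G : SimpleGraph V) (l r : V → ℝ) : Prop where
  lt : ∀ v, l v < r v
  lt_add_one : ∀ v, r v < l v + 1
  adj_iff : ∀ u w, G.Adj u w ↔ u ≠ w ∧ ∃ m : ℤ, l u < r w + m ∧ l w + m < r u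

section Arcs

variable {V : Type*}

/-- The arc of `u` is not properly contained in another arc. -/
def IsMaximalArc (l r : V → ℝ) (u : V) : Prop :=
  ∀ (w : V) (m : ℤ), l w + m ≤ l u → r u ≤ r w + m → l w + m = l u ∧ r w + m = r u

/-- The arc of `w` contains the right endpoint of the arc of `u` and starts inside it. -/
def Linked (l r : V → ℝ) (u w : V) : Prop :=
  ∃ b : ℤ, l u < l w + b ∧ l w + b < r u ∧ r u < r w + b

/-- The arc of `a` starts after that of `u`, ends before that of `w`, and contains the overlap
of these two linked arcs. -/
def Between (l r : V → ℝ) (u w a : V) : Prop :=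
  ∃ i b : ℤ, l u < l a + i ∧ l a + i < l w + b ∧ l w + b < r u ∧ r u < r a + i ∧
    r a + i < r w + b

/-- The integer translation that moves `l v` into `[l c, l c + 1)`. -/
def shift (l : V → ℝ) (c v : V) : ℤ := -⌊l v - l c⌋

/-- The order of arcs by both endpoints after cutting the circle at `l c`. -/
def Below (l r : V → ℝ) (c : V) : V → V → Prop :=
  IntervalBelow (fun v => l v + shift l c v) (fun v => r v + shift l c v)

variable {l r : V → ℝ} {G : SimpleGraph V} {L : List V}

theorem le_add_shift (l : V → ℝ) (c v : V) : l c ≤ l v + shift l c v := by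
  have := Int.floor_le (l v - l c)
  simp only [shift, Int.cast_neg]
  linarith

theorem add_shift_lt (l : V → ℝ) (c v : V) : l v + shift l c v < l c + 1 := by
  have := Int.lt_floor_add_one (l v - l c)
  simp only [shift, Int.cast_neg]
  linarith

theorem shift_eq {c v : V} {b : ℤ} (h : l c ≤ l v + b) (h' : l v + b < l c + 1) :
    shift l c v = b := by
  have : ⌊l v - l c⌋ = -b := by
    rw [Int.floor_eq_iff]
    push_cast
    constructor <;> linarith
  simp [shift, this]

theorem IsArcModel.not_subset (hG : IsArcModel G l r) (h : LongestPathList G L)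
    (h2 : 2 ≤ L.length) {u v : V} (hu : u ∉ L) (hv : v ∈ L) (m : ℤ) (hl : l u ≤ l v + m) :
    r u < r v + m := by
  by_contra! hr
  obtain ⟨y, hy, hvy, hno⟩ := h.exists_adj h2 hv
  refine hno u hu ⟨(hG.adj_iff _ _).2 ⟨fun e => hu (e ▸ hv), m, ?_, ?_⟩,
    (hG.adj_iff _ _).2 ⟨fun e => hu (e ▸ hy), ?_⟩⟩
  · have := hG.lt v
    linarith
  · have := hG.lt v
    linarith
  · obtain ⟨-, k, h1, h2⟩ := (hG.adj_iff _ _).1 hvy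
    refine ⟨k + m, ?_, ?_⟩ <;> push_cast <;> linarith

theorem IsArcModel.shift_bounds (hG : IsArcModel G l r) (h : LongestPathList G L)
    (h2 : 2 ≤ L.length) {u v : V} (hmax : IsMaximalArc l r u) (hu : u ∉ L) (hv : v ∈ L) :
    l u < l v + shift l u v ∧ r u < r v + shift l u v ∧ r v + shift l u v < r u + 1 := by
  have h3 := le_add_shift l u v
  have h4 := add_shift_lt l u v
  have h5 := hG.not_subset h h2 hu hv _ h3
  refine ⟨?_, h5, ?_⟩
  · by_contra! h6
    have := (hmax v _ h6 h5.le).2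
    linarith
  · by_contra! h6
    have := (hmax v (shift l u v - 1) (by push_cast; linarith) (by push_cast; linarith)).1
    push_cast at this
    linarith

theorem IsArcModel.shift_bounds_of_not_adj (hG : IsArcModel G l r) (h : LongestPathList G L)
    (h2 : 2 ≤ L.length) {u v : V} (hmax : IsMaximalArc l r u) (hu : u ∉ L) (hv : v ∈ L)
    (huv : ¬ G.Adj u v) : r u ≤ l v + shift l u v ∧ r v + shift l u v ≤ l u + 1 := by
  obtain ⟨h3, h4, h5⟩ := hG.shift_bounds h h2 hmax hu hv
  have h6 := add_shift_lt l u v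
  have h7 := hG.lt u
  have hne : u ≠ v := fun e => hu (e ▸ hv)
  constructor
  · by_contra! h8
    exact huv ((hG.adj_iff _ _).2 ⟨hne, shift l u v, by linarith, h8⟩)
  · by_contra! h8
    refine huv ((hG.adj_iff _ _).2 ⟨hne, shift l u v - 1, ?_, ?_⟩) <;> push_cast <;> linarith

theorem IsArcModel.intervalMeets_shift (hG : IsArcModel G l r) (h : LongestPathList G L)
    (h2 : 2 ≤ L.length) {u x y : V} (hmax : IsMaximalArc l r u) (hu : u ∉ L) (hx : x ∈ L)
    (hy : y ∈ L) (hxy : G.Adj x y) (hno : ¬ G.Adj u x) :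
    IntervalMeets (fun v => l v + shift l u v) (fun v => r v + shift l u v) x y := by
  obtain ⟨h3, h4⟩ := hG.shift_bounds_of_not_adj h h2 hmax hu hx hno
  obtain ⟨h5, h6, h7⟩ := hG.shift_bounds h h2 hmax hu hy
  obtain ⟨-, k, h8, h9⟩ := (hG.adj_iff _ _).1 hxy
  have hk1 : ((k + shift l u x - shift l u y : ℤ) : ℝ) < 1 := by
    push_cast
    linarith
  have hk2 : (-1 : ℝ) < ((k + shift l u x - shift l u y : ℤ) : ℝ) := by
    push_cast
    linarith
  have hk : k + shift l u x - shift l u y = 0 := by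
    have a : k + shift l u x - shift l u y < 1 := by exact_mod_cast hk1
    have b : -1 < k + shift l u x - shift l u y := by exact_mod_cast hk2
    omega
  have hk' : (k : ℝ) = shift l u y - shift l u x := by
    have : k = shift l u y - shift l u x := by omega
    rw [this]
    push_cast
    ring
  rw [hk'] at h8 h9
  constructor <;> simp only <;> linarith

/-- A longest path that misses a maximal arc can be rearranged so that its order extends the
order of arcs by both endpoints on the circle cut at the missed arc. -/
theorem IsArcModel.exists_normal (hG : IsArcModel G l r) (h : LongestPathList G L)
    (h2 : 2 ≤ L.length) {u : V} (hmax : IsMaximalArc l r u) (hu : u ∉ L) :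
    ∃ L' : List V, L'.Perm L ∧ LongestPathList G L' ∧
      L'.Pairwise fun x y => ¬ Below l r u y x := by
  have hc : L.IsChain (IntervalMeets (fun v => l v + shift l u v)
      (fun v => r v + shift l u v)) := by
    rw [List.isChain_iff_forall_rel_of_append_cons_cons]
    intro x y A B hL
    subst hL
    have hxy : G.Adj x y := (List.isChain_append_cons_cons.1 h.1.2).2.1
    by_cases hux : G.Adj u x
    · have huy : ¬ G.Adj u y := fun huy => h.not_adj_consecutive hu ⟨hux, huy⟩
      exact (hG.intervalMeets_shift h h2 hmax hu (by simp) (by simp) hxy.symm huy).symm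
    · exact hG.intervalMeets_shift h h2 hmax hu (by simp) (by simp) hxy hux
  obtain ⟨L', hp, hc', hn⟩ := exists_perm_normal (by
    intro v
    have := hG.lt v
    simpa using this) L hc
  refine ⟨L', hp, h.of_perm hp ?_, hn⟩
  have hnd : L'.Nodup := hp.nodup_iff.2 h.1.1
  rw [List.isChain_iff_forall_rel_of_append_cons_cons] at hc' ⊢
  intro x y A B hL
  obtain ⟨h3, h4⟩ := hc' hL
  have hne : x ≠ y := by
    subst hL
    rw [List.nodup_append] at hnd
    have := hnd.2.1
    simp at this
    tauto
  refine (hG.adj_iff _ _).2 ⟨hne, shift l u y - shift l u x, ?_, ?_⟩ <;> push_cast <;>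
    simp only at h3 h4 <;> linarith

theorem IsArcModel.between_of_not_below_left (hG : IsArcModel G l r) (h : LongestPathList G L)
    (h2 : 2 ≤ L.length) {u w a : V} (hu : u ∉ L) (ha : a ∈ L) (hmu : IsMaximalArc l r u)
    (hmw : IsMaximalArc l r w) (huw : Linked l r u w)
    (haw : ∀ m : ℤ, l w ≤ l a + m → r w < r a + m) (hb : ¬ Below l r u w a) :
    Between l r u w a := by
  obtain ⟨b, h3, h4, h5⟩ := huw
  have hs : shift l u w = b := shift_eq h3.le (by have := hG.lt_add_one u; linarith)
  obtain ⟨h6, h7, h8⟩ := hG.shift_bounds h h2 hmu hu ha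
  simp only [Below, IntervalBelow, hs, not_and, not_lt] at hb
  have h9 : l a + shift l u a < l w + b := by
    by_contra! h9
    have h10 := haw (shift l u a - b) (by push_cast; linarith)
    push_cast at h10
    rcases h9.lt_or_eq with h9 | h9
    · have := hb h9
      linarith
    · have := (hmw a (shift l u a - b) (by push_cast; linarith) (by push_cast; linarith)).2
      push_cast at this
      linarith
  refine ⟨shift l u a, b, h6, h9, h4, h7, ?_⟩
  by_contra! h10
  have := (hmw a (shift l u a - b) (by push_cast; linarith) (by push_cast; linarith)).1
  push_cast at this
  linarith

theorem IsArcModel.between_of_not_below_right (hG : IsArcModel G l r) (h : LongestPathList G L)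
    (h2 : 2 ≤ L.length) {u w a : V} (hw : w ∉ L) (ha : a ∈ L) (hmu : IsMaximalArc l r u)
    (hmw : IsMaximalArc l r w) (huw : Linked l r u w)
    (hau : ∀ m : ℤ, l u ≤ l a + m → r u < r a + m) (hb : ¬ Below l r w a u) :
    Between l r u w a := by
  obtain ⟨b, h3, h4, h5⟩ := huw
  have h1u := hG.lt_add_one u
  have hs : shift l w u = 1 - b := shift_eq (by push_cast; linarith) (by push_cast; linarith)
  obtain ⟨h6, h7, h8⟩ := hG.shift_bounds h h2 hmw hw ha
  have h11 := add_shift_lt l w a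
  simp only [Below, IntervalBelow, hs, not_and, not_lt] at hb
  push_cast at hb
  have h9 : l u + (1 - b) < l a + shift l w a := by
    by_contra! h9
    have h10 : r u ≤ r a + shift l w a + b - 1 := by
      rcases h9.lt_or_eq with h9 | h9
      · have := hb h9
        linarith
      · have := hau (shift l w a + b - 1) (by push_cast; linarith)
        push_cast at this
        linarith
    obtain ⟨e1, e2⟩ := hmu a (shift l w a + b - 1) (by push_cast; linarith)
      (by push_cast; linarith)
    have := hau (shift l w a + b - 1) e1.ge
    linarith
  have h12 := hau (shift l w a + b - 1) (by push_cast; linarith)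
  push_cast at h12
  refine ⟨shift l w a + b - 1, b, ?_, ?_, h4, ?_, ?_⟩ <;> push_cast <;> linarith

theorem Between.below_right (hG : IsArcModel G l r) {u w a : V} (h : Between l r u w a) :
    Below l r w u a := by
  obtain ⟨i, b, h1, h2, h3, h4, h5⟩ := h
  have h1u := hG.lt_add_one u
  have hu : shift l w u = 1 - b := shift_eq (by push_cast; linarith) (by push_cast; linarith)
  have ha : shift l w a = i - b + 1 := shift_eq (by push_cast; linarith) (by push_cast; linarith)
  simp only [Below, IntervalBelow, hu, ha]
  push_cast
  constructor <;> linarith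

theorem Between.below_left (hG : IsArcModel G l r) {u w a : V} (h : Between l r u w a) :
    Below l r u a w := by
  obtain ⟨i, b, h1, h2, h3, h4, h5⟩ := h
  have h1u := hG.lt_add_one u
  have hw : shift l u w = b := shift_eq (by linarith) (by linarith)
  have ha : shift l u a = i := shift_eq (by linarith) (by linarith)
  simp only [Below, IntervalBelow, hw, ha]
  constructor <;> linarith

/-- A longest path that misses two linked arcs has no arc between them. -/
theorem Between.mem_or_mem (hG : IsArcModel G l r) (h : LongestPathList G L)
    (h2 : 2 ≤ L.length) {u w a : V} (hb : Between l r u w a) (ha : a ∈ L) : u ∈ L ∨ w ∈ L := by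
  by_contra! hn
  obtain ⟨hu, hw⟩ := hn
  obtain ⟨i, b, h3, h4, h5, h6, h7⟩ := hb
  obtain ⟨y, hy, hay, hno⟩ := h.exists_adj h2 ha
  obtain ⟨-, k, h8, h9⟩ := (hG.adj_iff _ _).1 hay
  by_cases hyu : l y + k + i < r u
  · refine hno u hu ⟨(hG.adj_iff _ _).2 ⟨fun e => hu (e ▸ ha), i, ?_, ?_⟩,
      (hG.adj_iff _ _).2 ⟨fun e => hu (e ▸ hy), k + i, ?_, ?_⟩⟩ <;> push_cast <;> linarith
  · have := hG.lt y
    refine hno w hw ⟨(hG.adj_iff _ _).2 ⟨fun e => hw (e ▸ ha), i - b, ?_, ?_⟩,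
      (hG.adj_iff _ _).2 ⟨fun e => hw (e ▸ hy), k + i - b, ?_, ?_⟩⟩ <;> push_cast <;> linarith

theorem Linked.adj (hG : IsArcModel G l r) {u w : V} (h : Linked l r u w) : G.Adj u w := by
  obtain ⟨b, h1, h2, h3⟩ := h
  have h4 := hG.lt_add_one u
  refine (hG.adj_iff _ _).2 ⟨?_, b, by linarith, h2⟩
  rintro rfl
  have hb0 : (0 : ℝ) < b := by linarith
  have hb1 : (b : ℝ) < 1 := by linarith
  have : (0 : ℤ) < b := by exact_mod_cast hb0
  have : b < (1 : ℤ) := by exact_mod_cast hb1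
  omega

end Arcs

section Exchange

variable {V : Type*} {G : SimpleGraph V} {l r : V → ℝ}

theorem PathList.bridge {X X' : List V} {a b : V} (hX : PathList G (X ++ [a]))
    (hX' : PathList G (X' ++ [b])) (p : G.Walk a b) (hp : p.IsPath)
    (hd : ∀ x ∈ X, x ∉ p.support) (hd' : ∀ x ∈ X', x ∉ p.support) (hXX' : ∀ x ∈ X, x ∉ X') :
    ∃ M, PathList G M ∧ M.length = X.length + X'.length + p.length + 1 := by
  obtain ⟨hn, hc⟩ := hX
  obtain ⟨hn', hc'⟩ := hX'
  rw [List.isChain_append] at hc hc'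
  rw [List.nodup_append] at hn hn'
  refine ⟨X ++ (p.support ++ X'.reverse), ⟨?_, ?_⟩, ?_⟩
  · rw [List.nodup_append, List.nodup_append]
    refine ⟨hn.1, ⟨hp.support_nodup, by simpa using hn'.1, ?_⟩, ?_⟩
    · rintro x hx y hy rfl
      exact hd' x (by simpa using hy) hx
    · rintro x hx y hy rfl
      rcases List.mem_append.1 hy with hy | hy
      · exact hd x hx hy
      · exact hXX' x hx (by simpa using hy)
  · rw [List.isChain_append, List.isChain_append]
    refine ⟨hc.1, ⟨p.isChain_adj_support, ?_, ?_⟩, ?_⟩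
    · rw [List.isChain_reverse]
      exact hc'.1.imp fun _ _ h => h.symm
    · intro x hx y hy
      rw [List.head?_reverse] at hy
      have hx' : x = b := by
        rw [List.getLast?_eq_getLast_of_ne_nil p.support_ne_nil, p.getLast_support] at hx
        simpa using hx.symm
      subst hx'
      exact (hc'.2.2 y hy x (by simp)).symm
    · intro x hx y hy
      have hy' : y = a := by
        rw [List.head?_append_of_ne_nil _ p.support_ne_nil,
          List.head?_eq_some_head p.support_ne_nil, p.head_support] at hy
        simpa using hy.symm
      subst hy'
      exact hc.2.2 x hx y (by simp)
  · simp
    omega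

theorem PathList.reverse {L : List V} (h : PathList G L) : PathList G L.reverse := by
  refine ⟨List.nodup_reverse.2 h.1, ?_⟩
  rw [List.isChain_reverse]
  exact h.2.imp fun _ _ h => h.symm

theorem PathList.left {A B : List V} {x : V} (h : PathList G (A ++ x :: B)) :
    PathList G (A ++ [x]) := by
  have e : A ++ x :: B = (A ++ [x]) ++ B := by simp
  rw [e] at h
  exact ⟨(List.nodup_append.1 h.1).1, (List.isChain_append.1 h.2).1⟩

theorem PathList.right {A B : List V} {x : V} (h : PathList G (A ++ x :: B)) :
    PathList G (B.reverse ++ [x]) := by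
  have h' := h.reverse
  rw [List.reverse_append, List.reverse_cons, List.append_assoc] at h'
  exact h'.left

/-- Two longest paths through `a` and `b` cannot be crossed over along a path from `a` to `b`. -/
theorem LongestPathList.exists_common {X Y X' Y' : List V} {a b : V}
    (hP : LongestPathList G (X ++ a :: Y)) (hQ : LongestPathList G (X' ++ b :: Y'))
    (p : G.Walk a b) (hp : p.IsPath) (hab : a ≠ b)
    (hpP : ∀ x ∈ p.support, x ∈ X ++ a :: Y → x = a)
    (hpQ : ∀ x ∈ p.support, x ∈ X' ++ b :: Y' → x = b) :
    (∃ x, x ∈ X ∧ x ∈ X') ∨ ∃ y, y ∈ Y ∧ y ∈ Y' := by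
  by_contra! hn
  have hndP := hP.1.1
  have hndQ := hQ.1.1
  rw [List.nodup_middle, List.nodup_cons] at hndP hndQ
  have haX : a ∉ X := fun h => hndP.1 (by simp [h])
  have haY : a ∉ Y := fun h => hndP.1 (by simp [h])
  have hbX : b ∉ X' := fun h => hndQ.1 (by simp [h])
  have hbY : b ∉ Y' := fun h => hndQ.1 (by simp [h])
  obtain ⟨M, hM, hMl⟩ := hP.1.left.bridge hQ.1.left p hp
    (fun x hx hxp => haX (hpP x hxp (by simp [hx]) ▸ hx))
    (fun x hx hxp => hbX (hpQ x hxp (by simp [hx]) ▸ hx)) hn.1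
  obtain ⟨N, hN, hNl⟩ := hP.1.right.bridge hQ.1.right p hp
    (fun x hx hxp => haY (hpP x hxp (by simp at hx; simp [hx]) ▸ (by simpa using hx)))
    (fun x hx hxp => hbY (hpQ x hxp (by simp at hx; simp [hx]) ▸ (by simpa using hx)))
    (by simpa using hn.2)
  have h1 := hP.2 M hM
  have h2 := hP.2 N hN
  have h3 := hQ.2 _ hP.1
  have h4 := hP.2 _ hQ.1
  have h5 : 0 < p.length := by
    rcases Nat.eq_zero_or_pos p.length with h | h
    · exact absurd (SimpleGraph.Walk.eq_of_length_eq_zero h) hab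
    · exact h
  simp at h1 h2 h3 h4 hMl hNl
  omega

theorem exists_walk_of_adj_succ (K : ℕ → V) (k : ℕ) (h : ∀ i < k, G.Adj (K i) (K (i + 1))) :
    ∃ p : G.Walk (K k) (K 0), ∀ x ∈ p.support, ∃ i ≤ k, x = K i := by
  induction k with
  | zero => exact ⟨SimpleGraph.Walk.nil, by simp⟩
  | succ k ih =>
    obtain ⟨p, hp⟩ := ih fun i hi => h i (by omega)
    refine ⟨SimpleGraph.Walk.cons (h k (by omega)).symm p, ?_⟩
    intro x hx
    rw [SimpleGraph.Walk.support_cons, List.mem_cons] at hx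
    rcases hx with rfl | hx
    · exact ⟨k + 1, le_rfl, rfl⟩
    · obtain ⟨i, hi, rfl⟩ := hp x hx
      exact ⟨i, by omega, rfl⟩

/-- Along a sequence of linked maximal arcs, there are no two longest paths such that one meets
exactly the last arc and the other exactly the first arc. -/
theorem IsArcModel.no_opposite_longest (hG : IsArcModel G l r) {P Q : List V}
    (hP : LongestPathList G P) (hQ : LongestPathList G Q) (hP2 : 2 ≤ P.length)
    (hQ2 : 2 ≤ Q.length) (K : ℕ → V) (j : ℕ) (hmax : ∀ i ≤ j + 1, IsMaximalArc l r (K i))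
    (hlink : ∀ i < j + 1, Linked l r (K i) (K (i + 1))) (hKP : ∀ i < j + 1, K i ∉ P)
    (hkP : K (j + 1) ∈ P) (h0Q : K 0 ∈ Q) (hKQ : ∀ i ≤ j, K (i + 1) ∉ Q) : False := by
  obtain ⟨P', hpP, hP', hnP⟩ := hG.exists_normal hP hP2 (hmax j (by omega)) (hKP j (by omega))
  obtain ⟨Q', hpQ, hQ', hnQ⟩ := hG.exists_normal hQ hQ2 (hmax 1 (by omega)) (hKQ 0 (by omega))
  have hKP' : ∀ i < j + 1, K i ∉ P' := fun i hi h => hKP i hi (hpP.mem_iff.1 h)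
  have hKQ' : ∀ i ≤ j, K (i + 1) ∉ Q' := fun i hi h => hKQ i hi (hpQ.mem_iff.1 h)
  have hP2' : 2 ≤ P'.length := hpP.length_eq.symm ▸ hP2
  have hQ2' : 2 ≤ Q'.length := hpQ.length_eq.symm ▸ hQ2
  obtain ⟨X, Y, rfl⟩ := List.append_of_mem (hpP.mem_iff.2 hkP)
  obtain ⟨X', Y', rfl⟩ := List.append_of_mem (hpQ.mem_iff.2 h0Q)
  obtain ⟨p, hp⟩ := exists_walk_of_adj_succ K (j + 1) fun i hi => (hlink i hi).adj hG
  classical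
  rcases hP'.exists_common hQ' p.bypass p.bypass_isPath
    (fun e => hKP' 0 (by omega) (by rw [← e]; simp))
    (fun x hx hxP => by
      obtain ⟨i, hi, rfl⟩ := hp x (p.support_bypass_subset_support hx)
      rcases hi.lt_or_eq with hi | rfl
      · exact absurd hxP (hKP' i hi)
      · rfl)
    (fun x hx hxQ => by
      obtain ⟨i, hi, rfl⟩ := hp x (p.support_bypass_subset_support hx)
      cases i with
      | zero => rfl
      | succ i => exact absurd hxQ (hKQ' i (by omega))) with ⟨a, haX, haX'⟩ | ⟨a, haY, haY'⟩
  · have hnb : ¬ Below l r (K j) (K (j + 1)) a :=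
      (List.pairwise_append.1 hnP).2.2 a haX (K (j + 1)) (by simp)
    have hb := hG.between_of_not_below_left hP' hP2' (hKP' j (by omega)) (by simp [haX])
      (hmax j (by omega)) (hmax (j + 1) le_rfl) (hlink j (by omega))
      (fun m => hG.not_subset hQ' hQ2' (hKQ' j le_rfl) (by simp [haX']) m) hnb
    cases j with
    | zero =>
      exact (List.pairwise_append.1 hnQ).2.2 a haX' (K 0) (by simp) (hb.below_right hG)
    | succ j =>
      rcases hb.mem_or_mem hG hQ' hQ2' (by simp [haX']) with h | h
      · exact hKQ' j (by omega) h
      · exact hKQ' (j + 1) le_rfl h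
  · have hnb : ¬ Below l r (K 1) a (K 0) :=
      (List.pairwise_cons.1 (List.pairwise_append.1 hnQ).2.1).1 a haY'
    have hb := hG.between_of_not_below_right hQ' hQ2' (hKQ' 0 (by omega)) (by simp [haY'])
      (hmax 0 (by omega)) (hmax 1 (by omega)) (hlink 0 (by omega))
      (fun m => hG.not_subset hP' hP2' (hKP' 0 (by omega)) (by simp [haY]) m) hnb
    cases j with
    | zero =>
      exact (List.pairwise_cons.1 (List.pairwise_append.1 hnP).2.1).1 a haY (hb.below_left hG)
    | succ j =>
      rcases hb.mem_or_mem hG hP' hP2' (by simp [haY]) with h | h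
      · exact hKP' 0 (by omega) h
      · exact hKP' 1 (by omega) h

/-- If linked maximal arcs meet the intersection of any two adjacent arcs, one of them lies on
every longest path. -/
theorem IsArcModel.exists_mem_longest (hG : IsArcModel G l r) (K : ℕ → V) (N : ℕ)
    (hmax : ∀ i ≤ N, IsMaximalArc l r (K i)) (hlink : ∀ i < N, Linked l r (K i) (K (i + 1)))
    (hmeet : ∀ a b, G.Adj a b → ∃ i ≤ N, (K i = a ∨ G.Adj (K i) a) ∧ (K i = b ∨ G.Adj (K i) b))
    (htwo : ∀ L, LongestPathList G L → 2 ≤ L.length) :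
    ∃ v, ∀ L, LongestPathList G L → v ∈ L := by
  by_contra! hno
  have hfin : ∀ L, LongestPathList G L → ∃ i ≤ N, K i ∈ L := by
    intro L hL
    by_contra! hmiss
    have h2 := htwo L hL
    obtain ⟨x, hx⟩ : ∃ x, x ∈ L := List.exists_mem_of_length_pos (by omega)
    obtain ⟨y, hy, hxy, hins⟩ := hL.exists_adj h2 hx
    obtain ⟨i, hi, hix, hiy⟩ := hmeet x y hxy
    have hiL := hmiss i hi
    exact hins (K i) hiL ⟨hix.resolve_left fun e => hiL (e ▸ hx),
      hiy.resolve_left fun e => hiL (e ▸ hy)⟩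
  have hstep : ∀ n ≤ N, ∃ L, LongestPathList G L ∧ ∀ i ≤ n, K i ∉ L := by
    intro n
    induction n with
    | zero =>
      intro _
      obtain ⟨L, hL, hKL⟩ := hno (K 0)
      exact ⟨L, hL, fun i hi => by rwa [Nat.le_zero.1 hi]⟩
    | succ n ih =>
      intro hn
      obtain ⟨P, hP, hPK⟩ := ih (by omega)
      by_contra! hall
      have hkP : K (n + 1) ∈ P := by
        obtain ⟨i, hi, hiP⟩ := hall P hP
        rcases hi.lt_or_eq with hi | rfl
        · exact absurd hiP (hPK i (by omega))
        · exact hiP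
      obtain ⟨Q, hQ, hQK⟩ := hno (K (n + 1))
      classical
      obtain ⟨i₀, hi₀, hi₀Q⟩ := hall Q hQ
      obtain ⟨m, hmQ, hmn, hge⟩ :
          ∃ m, K m ∈ Q ∧ m ≤ n + 1 ∧ ∀ i ≤ n + 1, K i ∈ Q → i ≤ m :=
        ⟨_, Nat.findGreatest_spec (P := fun i => K i ∈ Q) hi₀ hi₀Q, Nat.findGreatest_le _,
          fun i hi h => Nat.le_findGreatest (P := fun i => K i ∈ Q) hi h⟩
      have hm : m ≠ n + 1 := fun e => hQK (e ▸ hmQ)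
      obtain ⟨j, rfl⟩ : ∃ j, n = m + j := ⟨n - m, by omega⟩
      refine hG.no_opposite_longest hP hQ (htwo P hP) (htwo Q hQ) (fun i => K (m + i)) j
        (fun i hi => hmax _ (by omega)) (fun i hi => hlink _ (by omega))
        (fun i hi => hPK _ (by omega)) hkP hmQ (fun i hi h => ?_)
      have := hge (m + (i + 1)) (by omega) h
      omega
  obtain ⟨L, hL, hmiss⟩ := hstep N le_rfl
  obtain ⟨i, hi, hiL⟩ := hfin L hL
  exact hmiss i hi hiL

end Exchange

section Covering

variable {V : Type*} {G : SimpleGraph V} {l r : V → ℝ}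

/-- Some translate of `x` lies in the arc of `v`. -/
def ArcMem (l r : V → ℝ) (x : ℝ) (v : V) : Prop :=
  ∃ m : ℤ, l v + m < x ∧ x < r v + m

theorem ArcMem.of_add_int {x : ℝ} {v : V} (m : ℤ) (h : ArcMem l r (x + m) v) :
    ArcMem l r x v := by
  obtain ⟨k, h1, h2⟩ := h
  refine ⟨k - m, ?_, ?_⟩ <;> push_cast <;> linarith

theorem exists_isMaximalArc_superset [Finite V] (l r : V → ℝ) (v : V) :
    ∃ (w : V) (m : ℤ), IsMaximalArc l r w ∧ l w + m ≤ l v ∧ r v ≤ r w + m := by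
  have : Nonempty {w : V // ∃ m : ℤ, l w + m ≤ l v ∧ r v ≤ r w + m} := ⟨v, 0, by simp⟩
  obtain ⟨⟨w, m, h1, h2⟩, hw⟩ := Finite.exists_max
    fun w : {w : V // ∃ m : ℤ, l w + m ≤ l v ∧ r v ≤ r w + m} => r w.1 - l w.1
  refine ⟨w, m, fun z k h3 h4 => ?_, h1, h2⟩
  have := hw ⟨z, k + m, by push_cast; linarith, by push_cast; linarith⟩
  dsimp only at this
  constructor <;> linarith

theorem IsMaximalArc.exists_linked [Finite V] {u : V} (hu : IsMaximalArc l r u)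
    (h : ∃ v, ArcMem l r (r u) v) : ∃ w, IsMaximalArc l r w ∧ Linked l r u w := by
  obtain ⟨v, m, h1, h2⟩ := h
  obtain ⟨w, k, hw, h3, h4⟩ := exists_isMaximalArc_superset l r v
  refine ⟨w, hw, m + k, ?_, by push_cast; linarith, by push_cast; linarith⟩
  by_contra! h5
  have := (hu w (m + k) h5 (by push_cast; linarith)).2
  push_cast at this
  linarith

theorem exists_isMaximalArc_start [Finite V] [Nonempty V] (hlr : ∀ v, l v < r v) :
    ∃ u, IsMaximalArc l r u ∧ ((∀ x, ∃ v, ArcMem l r x v) ∨ ¬ ∃ v, ArcMem l r (l u) v) := by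
  by_cases hx : ∀ x, ∃ v, ArcMem l r x v
  · obtain ⟨w, -, hw, -⟩ := exists_isMaximalArc_superset l r (Classical.arbitrary V)
    exact ⟨w, hw, Or.inl hx⟩
  push Not at hx
  obtain ⟨x, hx⟩ := hx
  have hs1 : ∀ v, x ≤ l v + ((-⌊l v - x⌋ : ℤ) : ℝ) := fun v => by
    have := Int.floor_le (l v - x)
    push_cast
    linarith
  have hs2 : ∀ v, l v + ((-⌊l v - x⌋ : ℤ) : ℝ) < x + 1 := fun v => by
    have := Int.lt_floor_add_one (l v - x)
    push_cast
    linarith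
  obtain ⟨v, hv⟩ := Finite.exists_min fun v => l v + ((-⌊l v - x⌋ : ℤ) : ℝ)
  have hfree : ∀ w, ¬ ArcMem l r (l v) w := by
    rintro w ⟨m, h1, h2⟩
    have h3 := hs1 v
    have h4 := hs2 v
    have h5 := hv w
    rcases le_or_gt x (l w + ((m + -⌊l v - x⌋ : ℤ) : ℝ)) with h6 | h6
    · have : ⌊l w - x⌋ = -(m + -⌊l v - x⌋) := by
        rw [Int.floor_eq_iff]
        push_cast at *
        constructor <;> linarith
      rw [this] at h5
      push_cast at *
      linarith
    · refine hx w ⟨m + -⌊l v - x⌋, h6, ?_⟩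
      push_cast at *
      linarith
  obtain ⟨w, m, hw, h1, h2⟩ := exists_isMaximalArc_superset l r v
  refine ⟨w, hw, Or.inr ?_⟩
  rintro ⟨z, hz⟩
  rcases h1.lt_or_eq with h1 | h1
  · exact hfree w ⟨m, h1, (hlr v).trans_le h2⟩
  · refine hfree z (ArcMem.of_add_int (-m) ?_)
    rw [← h1]
    simpa using hz

theorem exists_lift {K : ℕ → V} {N : ℕ} (hlink : ∀ i < N, Linked l r (K i) (K (i + 1))) :
    ∃ m : ℕ → ℤ, m 0 = 0 ∧ ∀ i < N, l (K (i + 1)) + m (i + 1) < r (K i) + m i ∧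
      r (K i) + m i < r (K (i + 1)) + m (i + 1) := by
  have : ∀ i, ∃ b : ℤ, i < N → l (K (i + 1)) + b < r (K i) ∧ r (K i) < r (K (i + 1)) + b := by
    intro i
    by_cases hi : i < N
    · obtain ⟨b, -, h⟩ := hlink i hi
      exact ⟨b, fun _ => h⟩
    · exact ⟨0, fun h => absurd h hi⟩
  choose b hb using this
  refine ⟨fun i => ∑ j ∈ Finset.range i, b j, by simp, fun i hi => ?_⟩
  have := hb i hi
  simp only [Finset.sum_range_succ]
  push_cast
  constructor <;> linarith

theorem exists_lt_of_le_of_lt {R : ℕ → ℝ} {x : ℝ} {a N : ℕ} (ha : R a ≤ x) (haN : a ≤ N)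
    (hx : x < R N) : ∃ k, a ≤ k ∧ k < N ∧ R k ≤ x ∧ x < R (k + 1) := by
  induction N, haN using Nat.le_induction with
  | base => exact absurd hx ha.not_gt
  | succ n hn ih =>
    rcases le_or_gt (R n) x with h | h
    · exact ⟨n, hn, by omega, h, hx⟩
    · obtain ⟨k, h1, h2, h3⟩ := ih h
      exact ⟨k, h1, by omega, h3⟩

theorem exists_arcMem_of_forall_linked [Finite V] {K : ℕ → V}
    (hlink : ∀ i, Linked l r (K i) (K (i + 1))) (x : ℝ) :
    ∃ i ≤ Nat.card V, ArcMem l r x (K i) := by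
  obtain ⟨m, -, hm⟩ := exists_lift (N := Nat.card V) (fun i _ => hlink i)
  have hmono : ∀ i j, i < j → j ≤ Nat.card V → r (K i) + m i < r (K j) + m j := by
    intro i j hij
    induction j, hij using Nat.le_induction with
    | base => exact fun h => (hm i (by omega)).2
    | succ j _ ih => exact fun h => (ih (by omega)).trans (hm j (by omega)).2
  obtain ⟨i, j, hij, hK⟩ : ∃ i j : Fin (Nat.card V + 1), i < j ∧ K i = K j := by
    have : ¬ Function.Injective fun i : Fin (Nat.card V + 1) => K i := fun h => by
      have := Nat.card_le_card_of_injective _ h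
      simp at this
    simp only [Function.Injective] at this
    push Not at this
    obtain ⟨i, j, h, hne⟩ := this
    rcases lt_or_gt_of_ne hne with hlt | hlt
    · exact ⟨i, j, hlt, h⟩
    · exact ⟨j, i, hlt, h.symm⟩
  have h1 := hmono i j hij (by omega)
  rw [hK] at h1
  have h2 : m i + 1 ≤ m j := by
    have : (m i : ℝ) < m j := by linarith
    exact_mod_cast this
  have h2' : (m i : ℝ) + 1 ≤ m j := by exact_mod_cast h2
  have h3 := Int.floor_le (x - (r (K i) + m i))
  have h4 := Int.lt_floor_add_one (x - (r (K i) + m i))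
  set n := ⌊x - (r (K i) + m i)⌋
  obtain ⟨k, -, hk, h5, h6⟩ := exists_lt_of_le_of_lt (R := fun i => r (K i) + m i)
    (x := x - n) (a := i) (N := j) (by linarith) hij.le
    (by rw [← hK]; linarith)
  refine ⟨k + 1, by omega, ArcMem.of_add_int (-n) ⟨m (k + 1), ?_, ?_⟩⟩
  · have := (hm k (by omega)).1
    push_cast
    linarith
  · push_cast
    linarith

theorem IsArcModel.exists_arcMem_of_stop (hG : IsArcModel G l r) (hconn : G.Connected)
    {K : ℕ → V} {N : ℕ} (hlink : ∀ i < N, Linked l r (K i) (K (i + 1)))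
    (h0 : ¬ ∃ v, ArcMem l r (l (K 0)) v) (hN : ¬ ∃ v, ArcMem l r (r (K N)) v) {x : ℝ} {v : V}
    (hx : ArcMem l r x v) : ∃ i ≤ N, ArcMem l r x (K i) := by
  obtain ⟨m, hm0, hm⟩ := exists_lift hlink
  have hmono : ∀ j ≤ N, r (K 0) ≤ r (K j) + m j := by
    intro j
    induction j with
    | zero => simp [hm0]
    | succ j ih => exact fun h => (ih (by omega)).trans (hm j (by omega)).2.le
  have hstep : ∀ a c, G.Adj a c → (∃ b : ℤ, l (K 0) ≤ l a + b ∧ r a + b ≤ r (K N) + m N) →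
      ∃ b : ℤ, l (K 0) ≤ l c + b ∧ r c + b ≤ r (K N) + m N := by
    rintro a c hac ⟨b, h1, h2⟩
    obtain ⟨-, k, h3, h4⟩ := (hG.adj_iff _ _).1 hac
    refine ⟨k + b, ?_, ?_⟩
    · by_contra! h5
      refine h0 ⟨c, k + b, h5, ?_⟩
      push_cast
      linarith
    · by_contra! h5
      refine hN ⟨c, k + b - m N, ?_, ?_⟩ <;> push_cast at * <;> linarith
  have hwalk : ∀ a c, G.Walk a c → (∃ b : ℤ, l (K 0) ≤ l a + b ∧ r a + b ≤ r (K N) + m N) →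
      ∃ b : ℤ, l (K 0) ≤ l c + b ∧ r c + b ≤ r (K N) + m N := by
    intro a c p
    induction p with
    | nil => exact id
    | cons h _ ih => exact fun ha => ih (hstep _ _ h ha)
  obtain ⟨p⟩ := hconn.preconnected (K 0) v
  have hin := hwalk _ _ p ⟨0, by simp, by simpa using hmono N le_rfl⟩
  obtain ⟨b, h1, h2⟩ := hin
  obtain ⟨k, h3, h4⟩ := hx
  rcases lt_or_ge (x + (b - k : ℤ)) (r (K 0)) with h5 | h5
  · refine ⟨0, by omega, ArcMem.of_add_int (b - k) ⟨0, ?_, ?_⟩⟩ <;> push_cast at * <;> linarith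
  · obtain ⟨i, -, hi, h6, h7⟩ := exists_lt_of_le_of_lt (R := fun i => r (K i) + m i)
      (x := x + (b - k : ℤ)) (a := 0) (N := N) (by simpa [hm0] using h5) (by omega)
      (by push_cast; linarith)
    have := (hm i hi).1
    exact ⟨i + 1, by omega, ArcMem.of_add_int (b - k) ⟨m (i + 1), by linarith, h7⟩⟩

theorem IsArcModel.exists_linked_sequence [Finite V] (hG : IsArcModel G l r)
    (hconn : G.Connected) : ∃ (K : ℕ → V) (N : ℕ), (∀ i ≤ N, IsMaximalArc l r (K i)) ∧
      (∀ i < N, Linked l r (K i) (K (i + 1))) ∧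
      ∀ x, (∃ v, ArcMem l r x v) → ∃ i ≤ N, ArcMem l r x (K i) := by
  have := hconn.nonempty
  obtain ⟨u, hu, hstart⟩ := exists_isMaximalArc_start hG.lt
  have hnext : ∀ u : {u // IsMaximalArc l r u}, ∃ w : {w // IsMaximalArc l r w},
      (∃ v, ArcMem l r (r u.1) v) → Linked l r u.1 w.1 := by
    intro u
    by_cases h : ∃ v, ArcMem l r (r u.1) v
    · obtain ⟨w, hw, hl⟩ := u.2.exists_linked h
      exact ⟨⟨w, hw⟩, fun _ => hl⟩
    · exact ⟨u, fun h' => absurd h' h⟩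
  choose f hf using hnext
  have hlink : ∀ i, (∃ v, ArcMem l r (r (f^[i] ⟨u, hu⟩).1) v) →
      Linked l r (f^[i] ⟨u, hu⟩).1 (f^[i + 1] ⟨u, hu⟩).1 := by
    intro i h
    rw [Function.iterate_succ_apply']
    exact hf _ h
  by_cases hall : ∀ i, ∃ v, ArcMem l r (r (f^[i] ⟨u, hu⟩).1) v
  · exact ⟨fun i => (f^[i] ⟨u, hu⟩).1, Nat.card V, fun i _ => (f^[i] ⟨u, hu⟩).2,
      fun i _ => hlink i (hall i), fun x _ => exists_arcMem_of_forall_linked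
        (K := fun i => (f^[i] ⟨u, hu⟩).1) (fun i => hlink i (hall i)) x⟩
  · push Not at hall
    classical
    have hN := Nat.find_spec hall
    have hlt : ∀ i < Nat.find hall, ∃ v, ArcMem l r (r (f^[i] ⟨u, hu⟩).1) v := by
      intro i hi
      have := Nat.find_min hall hi
      push Not at this
      exact this
    have h0 : ¬ ∃ v, ArcMem l r (l u) v :=
      hstart.resolve_left fun h => (h _).elim hN
    refine ⟨fun i => (f^[i] ⟨u, hu⟩).1, Nat.find hall, fun i _ => (f^[i] ⟨u, hu⟩).2,
      fun i hi => hlink i (hlt i hi), ?_⟩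
    rintro x ⟨v, hv⟩
    exact hG.exists_arcMem_of_stop hconn (K := fun i => (f^[i] ⟨u, hu⟩).1)
      (fun i hi => hlink i (hlt i hi)) h0 (fun ⟨w, hw⟩ => hN w hw) hv

theorem IsArcModel.adj_of_arcMem (hG : IsArcModel G l r) {u w : V} {x : ℝ}
    (hu : ArcMem l r x u) (hw : ArcMem l r x w) (hne : u ≠ w) : G.Adj u w := by
  obtain ⟨i, h1, h2⟩ := hu
  obtain ⟨j, h3, h4⟩ := hw
  refine (hG.adj_iff _ _).2 ⟨hne, j - i, ?_, ?_⟩ <;> push_cast <;> linarith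

theorem IsArcModel.exists_arcMem_of_adj (hG : IsArcModel G l r) {u w : V} (h : G.Adj u w) :
    ∃ x, ArcMem l r x u ∧ ArcMem l r x w := by
  obtain ⟨-, k, h1, h2⟩ := (hG.adj_iff _ _).1 h
  have h3 := hG.lt u
  have h4 := hG.lt w
  obtain ⟨x, hx1, hx2⟩ := exists_between (a₁ := max (l u) (l w + k)) (a₂ := min (r u) (r w + k))
    (by simp [h1, h2, h3, h4])
  rw [max_lt_iff] at hx1
  rw [lt_min_iff] at hx2
  exact ⟨x, ⟨0, by simpa using hx1.1, by simpa using hx2.1⟩, k, hx1.2, hx2.2⟩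

theorem IsArcModel.exists_mem_longestPathList [Finite V] (hG : IsArcModel G l r)
    (hconn : G.Connected) {u w : V} (huw : G.Adj u w) :
    ∃ v, ∀ L, LongestPathList G L → v ∈ L := by
  obtain ⟨K, N, hmax, hlink, hcov⟩ := hG.exists_linked_sequence hconn
  refine hG.exists_mem_longest K N hmax hlink (fun a b hab => ?_) fun L hL => ?_
  · obtain ⟨x, ha, hb⟩ := hG.exists_arcMem_of_adj hab
    obtain ⟨i, hi, hx⟩ := hcov x ⟨a, ha⟩
    exact ⟨i, hi, or_iff_not_imp_left.2 fun h => hG.adj_of_arcMem hx ha h,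
      or_iff_not_imp_left.2 fun h => hG.adj_of_arcMem hx hb h⟩
  · exact hL.2 [u, w] ⟨by simpa using huw.ne, by simpa using huw⟩

end Covering

section Circle

theorem Circ.coe_eq_coe_iff {s t : ℝ} : (s : Circ) = t ↔ ∃ m : ℤ, s = t + m := by
  rw [← sub_eq_zero, ← AddCircle.coe_sub, AddCircle.coe_eq_zero_iff]
  simp only [zsmul_eq_mul, mul_one]
  constructor <;> rintro ⟨m, hm⟩ <;> exact ⟨m, by linarith⟩

theorem arc_inter_arc_nonempty_iff (a b d e : ℝ) (hd : 0 < d) (he : 0 < e) :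
    (arc (a : Circ) d ∩ arc (b : Circ) e).Nonempty ↔
      ∃ m : ℤ, a < b + e + m ∧ b + m < a + d := by
  constructor
  · rintro ⟨_, ⟨s, hs, rfl⟩, t, ht, hst⟩
    dsimp only at hst
    rw [← AddCircle.coe_add, ← AddCircle.coe_add, Circ.coe_eq_coe_iff] at hst
    obtain ⟨m, hm⟩ := hst
    refine ⟨-m, ?_, ?_⟩ <;> push_cast <;> linarith [hs.1, hs.2, ht.1, ht.2]
  · rintro ⟨m, h1, h2⟩
    obtain ⟨x, hx1, hx2⟩ := exists_between (a₁ := max a (b + m)) (a₂ := min (a + d) (b + e + m))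
      (by simp [h1, h2, hd, he])
    rw [max_lt_iff] at hx1
    rw [lt_min_iff] at hx2
    refine ⟨(x : Circ), ⟨x - a, ⟨by linarith, by linarith⟩, ?_⟩, x - m - b,
      ⟨by linarith, by linarith⟩, ?_⟩
    · dsimp only
      rw [← AddCircle.coe_add, add_sub_cancel]
    · dsimp only
      rw [← AddCircle.coe_add, Circ.coe_eq_coe_iff]
      exact ⟨-m, by push_cast; ring⟩

theorem exists_isArcModel {V : Type*} {G : SimpleGraph V} {φ : V → Set Circ}
    (hφ : ∀ v, IsArc (φ v))
    (hadj : ∀ u w : V, u ≠ w → (G.Adj u w ↔ (φ u ∩ φ w).Nonempty)) :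
    ∃ l r : V → ℝ, IsArcModel G l r := by
  choose a d hd hd1 ha using hφ
  choose l hl using fun v => QuotientAddGroup.mk_surjective (a v)
  refine ⟨l, fun v => l v + d v, fun v => by linarith [hd v], fun v => by linarith [hd1 v],
    fun u w => ?_⟩
  have key : u ≠ w → (G.Adj u w ↔ ∃ m : ℤ, l u < l w + d w + m ∧ l w + m < l u + d u) := by
    intro h
    rw [hadj u w h, ← arc_inter_arc_nonempty_iff _ _ _ _ (hd u) (hd w), ha u, ha w, ← hl u, ← hl w]
  exact ⟨fun h => ⟨h.ne, (key h.ne).1 h⟩, fun h => (key h.1).2 h.2⟩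

end Circle

theorem longestPathList_support {V : Type*} {G : SimpleGraph V} {x y : V} {p : G.Walk x y}
    (hp : p.IsPath)
    (hmax : ∀ ⦃a b : V⦄ (q : G.Walk a b), q.IsPath → q.length ≤ p.length) :
    LongestPathList G p.support := by
  refine ⟨⟨hp.support_nodup, p.isChain_adj_support⟩, fun M hM => ?_⟩
  by_cases hne : M = []
  · simp [hne]
  · have h := hmax (SimpleGraph.Walk.ofSupport M hne hM.2)
      (by rw [SimpleGraph.Walk.isPath_def, SimpleGraph.Walk.support_ofSupport]; exact hM.1)
    rw [SimpleGraph.Walk.length_ofSupport] at h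
    rw [SimpleGraph.Walk.length_support]
    omega

/-- If `G` is a connected circular arc graph, then there is a vertex contained in every
longest path of `G`. -/
theorem stmt10 {V : Type*} [Fintype V] (G : SimpleGraph V) (φ : V → Set Circ)
    (hφ : ∀ v, IsArc (φ v))
    (hadj : ∀ u w : V, u ≠ w → (G.Adj u w ↔ (φ u ∩ φ w).Nonempty))
    (hconn : G.Connected) :
    ∃ v : V, ∀ (x y : V) (p : G.Walk x y), p.IsPath →
      (∀ ⦃a b : V⦄ (q : G.Walk a b), q.IsPath → q.length ≤ p.length) →
      v ∈ p.support := by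
  by_cases h : ∃ u w, G.Adj u w
  · obtain ⟨u, w, huw⟩ := h
    obtain ⟨l, r, hG⟩ := exists_isArcModel hφ hadj
    obtain ⟨v, hv⟩ := hG.exists_mem_longestPathList hconn huw
    exact ⟨v, fun x y p hp hmax => hv _ (longestPathList_support hp hmax)⟩
  · push Not at h
    obtain ⟨v⟩ := hconn.nonempty
    refine ⟨v, fun x y p _ _ => ?_⟩
    obtain ⟨q⟩ := hconn.preconnected v x
    cases q with
    | nil => exact p.start_mem_support
    | cons hvw _ => exact absurd hvw (h _ _)

end
end
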